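/- arXiv:2604.18989 — 2 statements merged into one kernel-verified Lean document; each statement's English description precedes it below -/
import Mathlib

section
/- Let d ≥ 1, L, ℓ > 0, λ ∈ [−ι, 4d+β+ι], and set B₁ = Q_L(x), B₂ = Q_{L+ℓ}(x) for some x ∈ ℤ^d. Suppose u solves the Dirichlet problem H(ω)u − λu = 0 in B₂ with u ≡ 0 on ∂⁺B₂. For y ∈ ∂⁺B₂ define the influence ℐ_u(y) = | Σ_{x∼y, x∈B₂} u(x) |. Then there exists a point ȳ ∈ ∂⁺B₂ with ℐ_u(ȳ) ≥ γ^{L+ℓ} · max_{n∈B₁} |u(n)|, where γ = 1/(4d + h + β). -/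
noncomputable section

open scoped ENNReal

namespace HierABM

/-- Sites of the lattice `ℤ^d`. -/
abbrev Site (d : ℕ) := Fin d → ℤ

variable {d : ℕ}

/-- The `ℓ∞`-norm of a lattice site (as a natural number). -/
def linf (x : Site d) : ℕ := Finset.univ.sup fun i => (x i).natAbs

/-- The `ℓ∞`-distance between two lattice sites (as a natural number). -/
def linfDist (x y : Site d) : ℕ := Finset.univ.sup fun i => (x i - y i).natAbs

/-- The `ℓ¹`-distance between two lattice sites; `x ∼ y` means `l1dist x y = 1`. -/
def l1dist (x y : Site d) : ℤ := ∑ i, |x i - y i|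

/-- The `i`-th standard basis vector of `ℤ^d`. -/
def unit (i : Fin d) : Site d := fun j => if j = i then 1 else 0

/-- The discrete Laplacian `Δf(x) = ∑_{y ∼ x} f(y)`. -/
def discLap (f : Site d → ℝ) (x : Site d) : ℝ :=
  ∑ i : Fin d, (f (x + unit i) + f (x - unit i))

/-- The pointwise action of `H(ω) = 2d - Δ + V_hi + β ω`. -/
def hamAct (Vhi : Site d → ℝ) (β : ℝ) (ω : Site d → Bool)
    (f : Site d → ℝ) (x : Site d) : ℝ :=
  (2 * d + Vhi x + β * (if ω x then 1 else 0)) * f x - discLap f x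

/-- The Newtonian scales `d_k = d₀^(α^k)`, i.e. `d_{k+1} = d_k^α`. -/
def nscale (d₀ α : ℝ) (k : ℕ) : ℝ := d₀ ^ (α ^ k)

/-- The block `Λ_k(j) = {x : |x - j|_∞ ≤ 2⌊3 d_k⌋}`. -/
def LambdaS (d₀ α : ℝ) (k : ℕ) (j : Site d) : Set (Site d) :=
  {x | (linfDist x j : ℤ) ≤ 2 * ⌊3 * nscale d₀ α k⌋}

/-- `diam A ≤ r` in the `ℓ∞`-metric. -/
def diamLE (A : Set (Site d)) (r : ℤ) : Prop :=
  ∀ a ∈ A, ∀ b ∈ A, (linfDist a b : ℤ) ≤ r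

/-- `dist(A, B) ≥ r` in the `ℓ∞`-metric. -/
def setDistGE (A B : Set (Site d)) (r : ℝ) : Prop :=
  ∀ a ∈ A, ∀ b ∈ B, r ≤ (linfDist a b : ℝ)

/-- The potential with zero set `W` is `(k, N)`-hierarchical in `Λ_k(j)`. -/
def IsHierIn (d₀ α : ℝ) (N : ℕ) (W : Set (Site d)) : ℕ → Site d → Prop
  | 0, _ => True
  | 1, j => ∃ (m : ℕ) (C : Fin (m + 1) → Set (Site d)),
      m + 1 ≤ N ∧
      W ∩ LambdaS d₀ α 1 j = ⋃ s, C s ∧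
      (∀ s, diamLE (C s) (4 * ⌊3 * d₀⌋)) ∧
      C 0 ⊆ LambdaS d₀ α 0 j ∧
      (∀ s t, s ≠ t → setDistGE (C s) (C t) (2 * nscale d₀ α 1))
  | (k + 2), j => ∃ (m : ℕ) (C : Fin (m + 1) → Set (Site d)),
      m + 1 ≤ N ∧
      W ∩ LambdaS d₀ α (k + 2) j = ⋃ s, C s ∧
      C 0 ⊆ LambdaS d₀ α (k + 1) j ∧
      (∀ s t, s ≠ t → setDistGE (C s) (C t) (2 * nscale d₀ α (k + 2))) ∧
      IsHierIn d₀ α N W (k + 1) j ∧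
      (∀ s : Fin (m + 1), s ≠ 0 → ∃ js : Site d,
        LambdaS d₀ α (k + 1) js ⊆ LambdaS d₀ α (k + 2) j ∧
        C s ⊆ LambdaS d₀ α (k + 1) js ∧
        IsHierIn d₀ α N W (k + 1) js)

/-- `V_hi` is a hierarchical potential with scales `d₀, α`, well density `N`
and barrier height `h`. -/
def IsHierPot (d₀ α : ℝ) (N : ℕ) (h : ℝ) (Vhi : Site d → ℝ) : Prop :=
  (∀ x, Vhi x = 0 ∨ Vhi x = h) ∧
  ∀ k : ℕ, 1 ≤ k → IsHierIn d₀ α N {x | Vhi x = 0} k 0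

/-- The parameter `ι = min{1/100, (h - 4d - β)/2}`. -/
def iota (d : ℕ) (h β : ℝ) : ℝ := min (1 / 100) ((h - 4 * d - β) / 2)

/-- `ℙ` is the i.i.d. Bernoulli(1/2) product measure on `{0,1}^{ℤ^d}`. -/
def IsBernoulliProduct (d : ℕ) (ℙ : MeasureTheory.Measure (Site d → Bool)) : Prop :=
  ∀ (S : Finset (Site d)) (v : Site d → Bool),
    ℙ {ω | ∀ x ∈ S, ω x = v x} = (1 / 2 : ℝ≥0∞) ^ S.card

/-- The lattice box of (integer) radius `R` about `c`, as a finset. -/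
def boxF {d : ℕ} (c : Site d) (R : ℤ) : Finset (Site d) :=
  Fintype.piFinset fun i => Finset.Icc (c i - R) (c i + R)

/-- The block `Λ_k(j)` as a finset. -/
def LambdaF {d : ℕ} (d₀ α : ℝ) (k : ℕ) (j : Site d) : Finset (Site d) :=
  boxF j (2 * ⌊3 * nscale d₀ α k⌋)

/-- `Λ̄_k(j)`, the `(d_{k+1}/10)`-neighborhood of `Λ_k(j)`, as a finset. -/
def barLambdaF {d : ℕ} (d₀ α : ℝ) (k : ℕ) (j : Site d) : Finset (Site d) :=
  boxF j (2 * ⌊3 * nscale d₀ α k⌋ + ⌊nscale d₀ α (k + 1) / 10⌋)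

/-- The Dirichlet restriction `H_Λ = R_Λ H(ω) R_Λ` of `H(ω) = 2d - Δ + V_hi + βω`,
as a matrix indexed by `Λ`: its entries are `2d + V_hi(x) + βω(x)` on the diagonal and
`-1` between nearest neighbors. -/
def HMat {d : ℕ} (Vhi : Site d → ℝ) (β : ℝ) (ω : Site d → Bool) (Λ : Finset (Site d)) :
    Matrix Λ Λ ℝ := fun x y =>
  (if x = y then 2 * d + Vhi (x : Site d) + β * (if ω (x : Site d) then 1 else 0) else 0)
  - (if l1dist (x : Site d) (y : Site d) = 1 then 1 else 0)
/-- The influence `ℐ_u(y) = |∑_{x ∼ y, x ∈ B} u(x)|` of `u` at a site `y` from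
inside `B`. -/
def influence {d : ℕ} (B : Finset (Site d)) (u : Site d → ℝ) (y : Site d) : ℝ :=
  |∑ i : Fin d, ((if y + unit i ∈ B then u (y + unit i) else 0) +
      (if y - unit i ∈ B then u (y - unit i) else 0))|

lemma mem_boxF {c z : Site d} {R : ℤ} : z ∈ boxF c R ↔ ∀ i, |z i - c i| ≤ R := by
  simp only [boxF, Fintype.mem_piFinset, Finset.mem_Icc, abs_le]
  exact forall_congr' fun i => by constructor <;> rintro ⟨h₁, h₂⟩ <;> constructor <;> linarith

lemma l1dist_add_smul_unit (z : Site d) (i : Fin d) {s : ℤ} (hs : s = 1 ∨ s = -1) :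
    l1dist z (z + s • unit i) = 1 := by
  have habs : |s| = 1 := by rcases hs with rfl | rfl <;> simp
  simp [l1dist, unit, habs, apply_ite abs]

/-- The Laplacian with the two neighbors in direction `±e_i` split off. -/
lemma discLap_eq_add_sum_erase (f : Site d → ℝ) (z : Site d) (i : Fin d) {s : ℤ}
    (hs : s = 1 ∨ s = -1) :
    discLap f z = f (z + s • unit i) + f (z - s • unit i) +
      ∑ j ∈ Finset.univ.erase i, (f (z + unit j) + f (z - unit j)) := by
  rw [discLap, ← Finset.add_sum_erase _ _ (Finset.mem_univ i)]
  rcases hs with rfl | rfl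
  · simp
  · simp only [neg_smul, one_smul, sub_neg_eq_add, ← sub_eq_add_neg]
    ring

/-- The value behind `z` in direction `s e_i` is controlled by the Laplacian at `z` and the
other neighbors of `z`. -/
lemma abs_sub_smul_unit_le (f : Site d → ℝ) (z : Site d) (i : Fin d) {s : ℤ}
    (hs : s = 1 ∨ s = -1) {A : ℝ} (hfront : |f (z + s • unit i)| ≤ A)
    (hside : ∀ j ≠ i, |f (z + unit j)| ≤ A ∧ |f (z - unit j)| ≤ A) :
    |f (z - s • unit i)| ≤ |discLap f z| + (2 * ((d : ℝ) - 1) + 1) * A := by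
  have hd : 1 ≤ d := i.pos
  have hsum : |∑ j ∈ Finset.univ.erase i, (f (z + unit j) + f (z - unit j))|
      ≤ ((d : ℝ) - 1) * (2 * A) := by
    refine (Finset.abs_sum_le_sum_abs _ _).trans ?_
    refine (Finset.sum_le_card_nsmul _ _ (2 * A) fun j hj => ?_).trans_eq ?_
    · obtain ⟨h₁, h₂⟩ := hside j (Finset.ne_of_mem_erase hj)
      linarith [abs_add_le (f (z + unit j)) (f (z - unit j))]
    · simp [Finset.card_erase_of_mem, Nat.cast_sub hd]
  have hsplit := discLap_eq_add_sum_erase f z i hs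
  generalize ∑ j ∈ Finset.univ.erase i, (f (z + unit j) + f (z - unit j)) = S at hsum hsplit
  have hback : f (z - s • unit i) = discLap f z - f (z + s • unit i) - S := by linarith
  rw [hback]
  linarith [abs_sub (discLap f z - f (z + s • unit i)) S,
    abs_sub (discLap f z) (f (z + s • unit i))]

/-- Propagation of a bound on the face of a box into its interior, layer by layer. -/
lemma abs_le_pow_mul_of_abs_discLap_le {c : Site d} {R : ℤ} {v : Site d → ℝ} (i : Fin d) {s : ℤ}
    (hs : s = 1 ∨ s = -1) {K G ε : ℝ} (hK : 0 ≤ K) (hG : K + 2 * ((d : ℝ) - 1) + 1 ≤ G)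
    (hε : 0 ≤ ε) (hout : ∀ z ∉ boxF c R, v z = 0)
    (hlap : ∀ z ∈ boxF c R, |discLap v z| ≤ K * |v z|)
    (hface : ∀ z, R ≤ s * (z i - c i) → |v z| ≤ ε) (k : ℕ) :
    ∀ z, R - k ≤ s * (z i - c i) → |v z| ≤ G ^ k * ε := by
  have hd : (1 : ℝ) ≤ d := by exact_mod_cast i.pos
  have hG1 : 1 ≤ G := by linarith
  have hss : s * s = 1 := by rcases hs with rfl | rfl <;> rfl
  induction k with
  | zero => simpa using hface
  | succ k ih =>
    intro z hz
    have hA : 0 ≤ G ^ k * ε := by positivity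
    by_cases hzk : R - k ≤ s * (z i - c i)
    · refine (ih z hzk).trans ?_
      gcongr
      exact k.le_succ
    by_cases hzB : z ∈ boxF c R
    swap
    · rw [hout z hzB, abs_zero]
      positivity
    set w : Site d := z + s • unit i with hw
    have hwi : s * (w i - c i) = s * (z i - c i) + 1 := by
      simp only [hw, unit, Pi.add_apply, Pi.smul_apply, smul_eq_mul, if_true, mul_one]
      linear_combination hss
    have hwj : ∀ j ≠ i, w j = z j := fun j hj => by simp [hw, unit, hj]
    push_cast at hz
    have hwB : w ∈ boxF c R := by
      rw [mem_boxF] at hzB ⊢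
      intro j
      by_cases hj : j = i
      · subst hj
        have := hzB j
        rw [abs_le] at this ⊢
        rcases hs with hs | hs <;> rw [hs] at hwi hzk <;> omega
      · rw [hwj j hj]
        exact hzB j
    have hwA : |v w| ≤ G ^ k * ε := ih w (by omega)
    have hfront : |v (w + s • unit i)| ≤ G ^ k * ε := by
      refine ih _ ?_
      have : s * ((w + s • unit i) i - c i) = s * (w i - c i) + 1 := by
        simp only [unit, Pi.add_apply, Pi.smul_apply, smul_eq_mul, if_true, mul_one]
        linear_combination hss
      omega
    have hside : ∀ j ≠ i, |v (w + unit j)| ≤ G ^ k * ε ∧ |v (w - unit j)| ≤ G ^ k * ε := by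
      intro j hj
      have hji : unit j i = 0 := by simp [unit, hj.symm]
      refine ⟨ih _ ?_, ih _ ?_⟩
      · rw [Pi.add_apply, hji, add_zero]; omega
      · rw [Pi.sub_apply, hji, sub_zero]; omega
    have hmain := abs_sub_smul_unit_le v w i hs hfront hside
    rw [hw, add_sub_cancel_right, ← hw] at hmain
    calc |v z| ≤ K * (G ^ k * ε) + (2 * ((d : ℝ) - 1) + 1) * (G ^ k * ε) :=
          hmain.trans (add_le_add_left ((hlap w hwB).trans (by gcongr)) _)
      _ = (K + 2 * ((d : ℝ) - 1) + 1) * (G ^ k * ε) := by ring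
      _ ≤ G * (G ^ k * ε) := by gcongr
      _ = G ^ (k + 1) * ε := by ring

lemma influence_eq_abs_discLap_indicator (B : Finset (Site d)) (u : Site d → ℝ) (y : Site d) :
    influence B u y = |discLap (fun z => if z ∈ B then u z else 0) y| := rfl

/-- Beyond a face of the box, the influence is the modulus of the function at the only neighbor
inside the box. -/
lemma influence_add_smul_unit {c : Site d} {R : ℤ} (u : Site d → ℝ) {z : Site d}
    (hz : z ∈ boxF c R) (i : Fin d) {s : ℤ} (hs : s = 1 ∨ s = -1) (hzi : s * (z i - c i) = R) :
    influence (boxF c R) u (z + s • unit i) = |u z| := by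
  have hout : ∀ y : Site d, R < s * (y i - c i) → y ∉ boxF c R := fun y hy hyB => by
    have := abs_le.1 (mem_boxF.1 hyB i)
    rcases hs with rfl | rfl <;> omega
  have hss : s * s = 1 := by rcases hs with rfl | rfl <;> rfl
  rw [influence_eq_abs_discLap_indicator, discLap_eq_add_sum_erase _ _ i hs, add_sub_cancel_right,
    if_pos hz, if_neg (hout _ ?_), Finset.sum_eq_zero, zero_add, add_zero]
  · intro j hj
    have hji : unit j i = 0 := by simp [unit, (Finset.ne_of_mem_erase hj).symm]
    rw [if_neg (hout _ ?_), if_neg (hout _ ?_), add_zero] <;>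
    · simp only [Pi.add_apply _ (unit j), Pi.sub_apply, hji, add_zero, sub_zero]
      rw [show (z + s • unit i) i = z i + s by simp [unit]]
      linarith
  · simp only [unit, Pi.add_apply, Pi.smul_apply, smul_eq_mul, if_true]
    linarith

lemma abs_potential_sub_le {h β lam V t : ℝ} (hh : 4 * (d : ℝ) + 1 < h) (hβ0 : 0 < β)
    (hV : V = 0 ∨ V = h) (ht : t = 0 ∨ t = 1)
    (hlam : lam ∈ Set.Icc (-(iota d h β)) (4 * (d : ℝ) + β + iota d h β)) :
    |2 * d + V + β * t - lam| ≤ 2 * d + h + β + 1 := by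
  have hι : iota d h β ≤ 1 / 100 := min_le_left _ _
  have hd : (0 : ℝ) ≤ d := d.cast_nonneg
  obtain ⟨h₁, h₂⟩ := hlam
  rw [abs_le]
  rcases hV with rfl | rfl <;> rcases ht with rfl | rfl <;> constructor <;> linarith

/-- **Lower bound on the boundary influence of a Dirichlet eigenfunction**
(Lemma 2.2).

Let `B₁ = Q_L(x) ⊆ B₂ = Q_{L+ℓ}(x)`, let `λ ∈ [-ι, 4d+β+ι]`, and let `u` solve
`H(ω)u - λu = 0` in `B₂` with `u ≡ 0` on `∂⁺B₂`.  Then some boundary site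
`ȳ ∈ ∂⁺B₂` satisfies `ℐ_u(ȳ) ≥ γ^{L+ℓ} · max_{n ∈ B₁} |u(n)|`, where
`γ = 1/(4d + h + β)`. -/
theorem boundary_influence_lower_bound
    (d : ℕ) (hd : 1 ≤ d)
    (h : ℝ) (hh : 4 * (d : ℝ) + 1 < h)
    (β : ℝ) (hβ0 : 0 < β) (hβ1 : β ≤ 1)
    (Vhi : Site d → ℝ) (hV : ∀ x, Vhi x = 0 ∨ Vhi x = h)
    (ω : Site d → Bool)
    (lam : ℝ) (hlam : lam ∈ Set.Icc (-(iota d h β)) (4 * (d : ℝ) + β + iota d h β))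
    (x : Site d) (L ℓ : ℕ) (hL : 0 < L) (hℓ : 0 < ℓ)
    (u : Site d → ℝ)
    (hsol : ∀ z ∈ boxF x ((L : ℤ) + ℓ), hamAct Vhi β ω u z = lam * u z)
    (hbdry : ∀ y : Site d, y ∉ boxF x ((L : ℤ) + ℓ) →
      (∃ z ∈ boxF x ((L : ℤ) + ℓ), l1dist z y = 1) → u y = 0) :
    ∃ ybar : Site d, ybar ∉ boxF x ((L : ℤ) + ℓ) ∧
      (∃ z ∈ boxF x ((L : ℤ) + ℓ), l1dist z ybar = 1) ∧
      ∀ n ∈ boxF x (L : ℤ),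
        (1 / (4 * (d : ℝ) + h + β)) ^ (L + ℓ) * |u n| ≤
          influence (boxF x ((L : ℤ) + ℓ)) u ybar := by
  have hdR : (1 : ℝ) ≤ d := by exact_mod_cast hd
  set i : Fin d := ⟨0, hd⟩
  set R : ℤ := (L : ℤ) + ℓ
  set v : Site d → ℝ := fun z => if z ∈ boxF x R then u z else 0
  have hvin : ∀ z ∈ boxF x R, v z = u z := fun z hz => if_pos hz
  have hvout : ∀ z ∉ boxF x R, v z = 0 := fun z hz => if_neg hz
  have hnbr : ∀ z ∈ boxF x R, ∀ (j : Fin d) (s : ℤ), s = 1 ∨ s = -1 →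
      v (z + s • unit j) = u (z + s • unit j) := by
    intro z hz j s hs
    by_cases hy : z + s • unit j ∈ boxF x R
    · exact hvin _ hy
    · rw [hvout _ hy, hbdry _ hy ⟨z, hz, l1dist_add_smul_unit z j hs⟩]
  have hlap : ∀ z ∈ boxF x R, |discLap v z| ≤ (2 * d + h + β + 1) * |v z| := by
    intro z hz
    have hvu : discLap v z = discLap u z := by
      refine Finset.sum_congr rfl fun j _ => ?_
      have hp := hnbr z hz j 1 (.inl rfl)
      have hm := hnbr z hz j (-1) (.inr rfl)
      rw [one_smul] at hp
      rw [neg_smul, one_smul, ← sub_eq_add_neg] at hm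
      rw [hp, hm]
    have heq := hsol z hz
    rw [hamAct] at heq
    rw [hvu, hvin z hz, show discLap u z =
      (2 * d + Vhi z + β * (if ω z then 1 else 0) - lam) * u z by linarith, abs_mul]
    gcongr
    exact abs_potential_sub_le hh hβ0 (hV z) (by split_ifs <;> simp) hlam
  set F : Finset (Site d) := (boxF x R).filter fun z => |z i - x i| = R with hF
  have hFne : F.Nonempty := by
    refine ⟨fun j => x j + R, ?_⟩
    have hRabs : |R| = R := abs_of_nonneg (by omega)
    simp [hF, mem_boxF, hRabs]
  obtain ⟨z, hzF, hzmax⟩ := F.exists_max_image (fun z => |u z|) hFne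
  obtain ⟨hzB, hzi⟩ := Finset.mem_filter.1 hzF
  obtain ⟨s, hs, hsz⟩ : ∃ s : ℤ, (s = 1 ∨ s = -1) ∧ s * (z i - x i) = R := by
    rcases abs_choice (z i - x i) with habs | habs
    · exact ⟨1, .inl rfl, by omega⟩
    · exact ⟨-1, .inr rfl, by omega⟩
  refine ⟨z + s • unit i, fun hy => ?_, ⟨z, hzB, l1dist_add_smul_unit z i hs⟩, fun n hn => ?_⟩
  · have := abs_le.1 (mem_boxF.1 hy i)
    simp only [unit, Pi.add_apply, Pi.smul_apply, smul_eq_mul, if_true] at this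
    rcases hs with rfl | rfl <;> omega
  rw [influence_add_smul_unit u hzB i hs hsz]
  have hG : 0 < 4 * (d : ℝ) + h + β := by linarith
  rw [one_div, inv_pow, inv_mul_le_iff₀ (by positivity)]
  have hnB : n ∈ boxF x R := mem_boxF.2 fun j => (mem_boxF.1 hn j).trans (by omega)
  -- Propagate from the face on the side of `x` on which `n` lies.
  obtain ⟨t, ht, htn⟩ : ∃ t : ℤ, (t = 1 ∨ t = -1) ∧ 0 ≤ t * (n i - x i) := by
    rcases le_total 0 (n i - x i) with hsgn | hsgn
    · exact ⟨1, .inl rfl, by omega⟩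
    · exact ⟨-1, .inr rfl, by omega⟩
  have hface : ∀ y, R ≤ t * (y i - x i) → |v y| ≤ |u z| := by
    intro y hy
    by_cases hyB : y ∈ boxF x R
    · rw [hvin y hyB]
      refine hzmax y (Finset.mem_filter.2 ⟨hyB, le_antisymm (mem_boxF.1 hyB i) ?_⟩)
      rw [le_abs]
      rcases ht with rfl | rfl <;> omega
    · simp [hvout y hyB]
  rw [← hvin n hnB]
  exact abs_le_pow_mul_of_abs_discLap_le i ht (by linarith) (by linarith) (abs_nonneg _) hvout hlap
    hface (L + ℓ) n (by push_cast; omega)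

end HierABM
end
end

section
/- (Green's function bounds on non-resonant sets.) Let d ≥ 1, h > 4d+1, 0 < β ≤ 1, ι = min{1/100, (h−4d−β)/2}, and let Λ ⊂ ℤ^d be a finite non-resonant set, i.e. Λ ⊂ {x : V_hi(x) = h}. Then for every E ∈ [−ι, 4d+β+ι], the Dirichlet restriction H_Λ − E is invertible, its inverse G_Λ(E) satisfies the operator-norm bound ‖G_Λ(E)‖ ≤ 1/(h−4d−β−ι), and its matrix entries satisfy |G_Λ(x,y;E)| ≤ (1/(h−4d−β−ι)) · exp(−γ₀ |x−y|₁) for all x, y ∈ Λ, where γ₀ = log(1 + (h−4d−β−ι)/(2d)) > 0. -/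
noncomputable section

open scoped ENNReal

namespace HierABM

variable {d : ℕ}

/-- The rate `γ₀ = log(1 + (h - 4d - β - ι)/(2d))`. -/
def gamma0 (d : ℕ) (h β : ℝ) : ℝ :=
  Real.log (1 + (h - 4 * d - β - iota d h β) / (2 * d))

open Finset Matrix in
/-- Coercivity of a diagonally dominant matrix `diagonal a - N` with `N` symmetric, entrywise
nonnegative, of row sums at most `s`. -/
theorem coercive_of_dominant {n : Type*} [Fintype n] [DecidableEq n] {a : n → ℝ}
    {N : Matrix n n ℝ} {s δ : ℝ} (hN : ∀ x y, 0 ≤ N x y) (hsymm : ∀ x y, N x y = N y x)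
    (hrow : ∀ x, ∑ y, N x y ≤ s) (ha : ∀ x, s + δ ≤ a x) (v : n → ℝ) :
    δ * ∑ x, v x ^ 2 ≤ ∑ x, v x * (diagonal a - N).mulVec v x := by
  have hrows : ∑ x, ∑ y, N x y * v x ^ 2 ≤ s * ∑ x, v x ^ 2 := by
    rw [mul_sum]
    refine sum_le_sum fun x _ => ?_
    rw [← sum_mul]
    exact mul_le_mul_of_nonneg_right (hrow x) (sq_nonneg _)
  have hcols : ∑ x, ∑ y, N x y * v y ^ 2 = ∑ x, ∑ y, N x y * v x ^ 2 := by
    rw [sum_comm]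
    exact sum_congr rfl fun x _ => sum_congr rfl fun y _ => by rw [hsymm]
  have hoff : ∑ x, v x * N.mulVec v x ≤ s * ∑ x, v x ^ 2 := by
    calc ∑ x, v x * N.mulVec v x
        ≤ ∑ x, ∑ y, (N x y * v x ^ 2 + N x y * v y ^ 2) / 2 := by
          refine sum_le_sum fun x _ => ?_
          simp only [mulVec, dotProduct, mul_sum]
          refine sum_le_sum fun y _ => ?_
          nlinarith [mul_nonneg (hN x y) (sq_nonneg (v x - v y))]
      _ = (∑ x, ∑ y, N x y * v x ^ 2 + ∑ x, ∑ y, N x y * v y ^ 2) / 2 := by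
          simp only [← sum_div, sum_add_distrib]
      _ ≤ s * ∑ x, v x ^ 2 := by rw [hcols]; linarith
  have hdiag : (s + δ) * ∑ x, v x ^ 2 ≤ ∑ x, v x * (a x * v x) := by
    rw [mul_sum]
    refine sum_le_sum fun x _ => ?_
    nlinarith [mul_le_mul_of_nonneg_right (ha x) (sq_nonneg (v x))]
  simp only [sub_mulVec, Pi.sub_apply, mulVec_diagonal, mul_sub, sum_sub_distrib]
  linarith

open Finset Matrix in
/-- A coercive matrix expands the `ℓ²`-norm. -/
theorem sqrt_le_of_coercive {n : Type*} [Fintype n] {A : Matrix n n ℝ} {δ : ℝ} (hδ : 0 < δ)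
    (hA : ∀ v : n → ℝ, δ * ∑ x, v x ^ 2 ≤ ∑ x, v x * A.mulVec v x) (v : n → ℝ) :
    Real.sqrt (∑ x, v x ^ 2) ≤ (1 / δ) * Real.sqrt (∑ x, A.mulVec v x ^ 2) := by
  have hcs := (hA v).trans (Real.sum_mul_le_sqrt_mul_sqrt univ v (A.mulVec v))
  have hsq := Real.sq_sqrt (sum_nonneg fun x (_ : x ∈ univ) => sq_nonneg (v x))
  rcases (Real.sqrt_nonneg (∑ x, v x ^ 2)).eq_or_lt with h0 | hpos
  · rw [← h0]
    positivity
  · rw [one_div_mul_eq_div, le_div_iff₀ hδ]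
    refine le_of_mul_le_mul_left ?_ hpos
    nlinarith

open Matrix in
/-- A coercive matrix is invertible. -/
theorem isUnit_of_coercive {n : Type*} [Fintype n] [DecidableEq n] {A : Matrix n n ℝ} {δ : ℝ}
    (hδ : 0 < δ) (hA : ∀ v : n → ℝ, δ * ∑ x, v x ^ 2 ≤ ∑ x, v x * A.mulVec v x) :
    IsUnit A := by
  rw [← mulVec_injective_iff_isUnit]
  refine (injective_iff_map_eq_zero A.mulVecLin).2 fun v hv => ?_
  replace hv : A.mulVec v = 0 := hv
  have hle := hA v
  simp only [hv, Pi.zero_apply, mul_zero, Finset.sum_const_zero] at hle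
  have hsum : ∑ x, v x ^ 2 = 0 :=
    le_antisymm (by by_contra! hc; nlinarith) (Finset.sum_nonneg fun x _ => sq_nonneg _)
  rw [Finset.sum_eq_zero_iff_of_nonneg fun x _ => sq_nonneg _] at hsum
  exact funext fun x => pow_eq_zero_iff two_ne_zero |>.1 (hsum x (Finset.mem_univ x))

open Finset Matrix in
/-- Geometric decay away from `y` of the entries of the inverse of `diagonal a - N`, when `N` only
connects points whose distance `ρ` to `y` differs by at most one. -/
theorem abs_inv_entry_le {n : Type*} [Fintype n] [DecidableEq n] {a : n → ℝ}
    {N G : Matrix n n ℝ} {s δ C : ℝ} (hs : 0 ≤ s) (hδ : 0 < δ) (hN : ∀ x y, 0 ≤ N x y)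
    (hrow : ∀ x, ∑ y, N x y ≤ s) (ha : ∀ x, s + δ ≤ a x) (hG : (diagonal a - N) * G = 1)
    {y : n} (hC : ∀ x, |G x y| ≤ C) {ρ : n → ℕ} (hρy : ρ y = 0)
    (hρ : ∀ x z, N x z ≠ 0 → ρ x ≤ ρ z + 1) (k : ℕ) :
    ∀ x, k ≤ ρ x → |G x y| ≤ C * (s / (s + δ)) ^ k := by
  have hC0 : 0 ≤ C := (abs_nonneg _).trans (hC y)
  induction k with
  | zero => simpa using hC
  | succ k ih =>
    intro x hx
    have hxy : x ≠ y := by rintro rfl; omega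
    have hentry := congrFun (congrFun hG x) y
    rw [sub_mul, Matrix.sub_apply, diagonal_mul, one_apply_ne hxy, sub_eq_zero,
      Matrix.mul_apply] at hentry
    have hbound : a x * |G x y| ≤ s * (C * (s / (s + δ)) ^ k) := by
      calc a x * |G x y| = |∑ z, N x z * G z y| := by
            rw [← hentry, abs_mul, abs_of_nonneg (a := a x) (by linarith [ha x])]
        _ ≤ ∑ z, |N x z * G z y| := abs_sum_le_sum_abs _ _
        _ ≤ ∑ z, N x z * (C * (s / (s + δ)) ^ k) := by
            refine sum_le_sum fun z _ => ?_
            rw [abs_mul, abs_of_nonneg (hN x z)]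
            rcases eq_or_ne (N x z) 0 with h0 | h0
            · simp [h0]
            · exact mul_le_mul_of_nonneg_left (ih z (by have := hρ x z h0; omega)) (hN x z)
        _ = (∑ z, N x z) * (C * (s / (s + δ)) ^ k) := (sum_mul ..).symm
        _ ≤ s * (C * (s / (s + δ)) ^ k) := mul_le_mul_of_nonneg_right (hrow x) (by positivity)
    have hmul : (s + δ) * |G x y| ≤ s * (C * (s / (s + δ)) ^ k) :=
      (mul_le_mul_of_nonneg_right (ha x) (abs_nonneg _)).trans hbound
    calc |G x y| ≤ s * (C * (s / (s + δ)) ^ k) / (s + δ) := by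
          rw [le_div_iff₀ (by positivity)]; linarith
      _ = C * (s / (s + δ)) ^ (k + 1) := by rw [pow_succ]; ring

theorem l1dist_nonneg (x y : Site d) : 0 ≤ l1dist x y :=
  Finset.sum_nonneg fun _ _ => abs_nonneg _

theorem l1dist_self (x : Site d) : l1dist x x = 0 := by simp [l1dist]

theorem l1dist_comm (x y : Site d) : l1dist x y = l1dist y x :=
  Finset.sum_congr rfl fun _ _ => abs_sub_comm _ _

theorem l1dist_triangle (x y z : Site d) : l1dist x z ≤ l1dist x y + l1dist y z := by
  rw [l1dist, l1dist, l1dist, ← Finset.sum_add_distrib]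
  exact Finset.sum_le_sum fun _ _ => abs_sub_le _ _ _

/-- The nearest neighbors of `x` are the points `x ± unit i`. -/
theorem exists_unit_of_l1dist_eq_one {x y : Site d} (hxy : l1dist x y = 1) :
    ∃ i, y = x + unit i ∨ y = x - unit i := by
  obtain ⟨i, -, hi⟩ := Finset.exists_ne_zero_of_sum_ne_zero (hxy.trans_ne one_ne_zero)
  have hsplit := Finset.add_sum_erase Finset.univ (fun j => |x j - y j|) (Finset.mem_univ i)
  have hpos : 0 < |x i - y i| := lt_of_le_of_ne (abs_nonneg _) (Ne.symm hi)
  have hrest : 0 ≤ ∑ j ∈ Finset.univ.erase i, |x j - y j| :=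
    Finset.sum_nonneg fun _ _ => abs_nonneg _
  simp only [l1dist] at hxy
  have hzero : ∑ j ∈ Finset.univ.erase i, |x j - y j| = 0 := by omega
  have hone : |x i - y i| = 1 := by omega
  rw [Finset.sum_eq_zero_iff_of_nonneg fun _ _ => abs_nonneg _] at hzero
  have heq : ∀ j, j ≠ i → x j = y j := fun j hj =>
    sub_eq_zero.1 (abs_eq_zero.1 (hzero j (by simp [hj])))
  refine ⟨i, ?_⟩
  rcases (abs_eq zero_le_one).1 hone with h1 | h1
  · right
    funext j
    by_cases hj : j = i
    · subst hj; simp only [Pi.sub_apply, unit, if_true]; omega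
    · simp [unit, hj, heq j hj]
  · left
    funext j
    by_cases hj : j = i
    · subst hj; simp only [Pi.add_apply, unit, if_true]; omega
    · simp [unit, hj, heq j hj]

/-- A site has at most `2d` nearest neighbors in a finite set. -/
theorem sum_adjacent_le (Λ : Finset (Site d)) (x : Site d) :
    ∑ y : Λ, (if l1dist x (y : Site d) = 1 then (1 : ℝ) else 0) ≤ 2 * d := by
  rw [Finset.sum_coe_sort Λ fun y => if l1dist x y = 1 then (1 : ℝ) else 0, Finset.sum_boole]
  have hsub : Λ.filter (fun y => l1dist x y = 1) ⊆
      Finset.univ.image (fun i => x + unit i) ∪ Finset.univ.image (fun i => x - unit i) := by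
    intro y hy
    obtain ⟨i, hi | hi⟩ := exists_unit_of_l1dist_eq_one (Finset.mem_filter.1 hy).2 <;>
      simp [hi]
  have hcard := (Finset.card_le_card hsub).trans ((Finset.card_union_le _ _).trans
    (add_le_add Finset.card_image_le Finset.card_image_le))
  rw [Finset.card_univ, Fintype.card_fin, ← two_mul] at hcard
  exact_mod_cast hcard

/-- The adjacency matrix of nearest neighbors in `Λ`. -/
def adjMat (Λ : Finset (Site d)) : Matrix Λ Λ ℝ := fun x y =>
  if l1dist (x : Site d) (y : Site d) = 1 then 1 else 0

theorem HMat_sub_smul_one (Vhi : Site d → ℝ) (β : ℝ) (ω : Site d → Bool) (Λ : Finset (Site d))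
    (E : ℝ) : HMat Vhi β ω Λ - E • (1 : Matrix Λ Λ ℝ) =
      Matrix.diagonal (fun x : Λ => 2 * d + Vhi x + β * (if ω x then 1 else 0) - E)
        - adjMat Λ := by
  ext x y
  by_cases hxy : x = y
  · subst hxy
    simp [HMat, adjMat, l1dist_self]
  · simp [HMat, adjMat, hxy]

/-- **Green's function bounds on non-resonant sets** (Lemma 3.1).

If the finite set `Λ` is non-resonant, i.e. `Λ ⊆ {x : V_hi(x) = h}`, then for every
`E ∈ [-ι, 4d+β+ι]` the matrix `H_Λ - E` is invertible, its inverse `G = G_Λ(E)`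
satisfies the `ℓ² → ℓ²` operator-norm bound `‖G‖ ≤ 1/(h-4d-β-ι)`, and its entries
decay exponentially: `|G(x,y)| ≤ (h-4d-β-ι)⁻¹ exp(-γ₀ |x-y|₁)`. -/
theorem green_function_nonresonant
    (d : ℕ) (hd : 1 ≤ d)
    (h : ℝ) (hh : 4 * (d : ℝ) + 1 < h)
    (β : ℝ) (hβ0 : 0 < β) (hβ1 : β ≤ 1)
    (Vhi : Site d → ℝ) (ω : Site d → Bool)
    (Λ : Finset (Site d)) (hΛ : ∀ x ∈ Λ, Vhi x = h)
    (E : ℝ) (hE : E ∈ Set.Icc (-(iota d h β)) (4 * (d : ℝ) + β + iota d h β)) :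
    ∃ G : Matrix Λ Λ ℝ,
      (HMat Vhi β ω Λ - E • (1 : Matrix Λ Λ ℝ)) * G = 1 ∧
      G * (HMat Vhi β ω Λ - E • (1 : Matrix Λ Λ ℝ)) = 1 ∧
      (∀ v : Λ → ℝ,
        Real.sqrt (∑ x, G.mulVec v x ^ 2) ≤
          (1 / (h - 4 * (d : ℝ) - β - iota d h β)) * Real.sqrt (∑ x, v x ^ 2)) ∧
      (∀ x y : Λ,
        |G x y| ≤ (1 / (h - 4 * (d : ℝ) - β - iota d h β)) *
          Real.exp (-(gamma0 d h β) * (l1dist (x : Site d) (y : Site d) : ℝ))) := by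
  set δ := h - 4 * (d : ℝ) - β - iota d h β with hδdef
  have hd0 : (0 : ℝ) < 2 * d := by
    have : (1 : ℝ) ≤ d := by exact_mod_cast hd
    linarith
  have hδ : 0 < δ := by
    have hι : iota d h β ≤ (h - 4 * d - β) / 2 := min_le_right _ _
    linarith
  rw [HMat_sub_smul_one]
  set a : Λ → ℝ := fun x => 2 * d + Vhi x + β * (if ω x then 1 else 0) - E with hadef
  have ha : ∀ x, 2 * (d : ℝ) + δ ≤ a x := by
    intro x
    have hω : 0 ≤ β * (if ω x then 1 else 0) := by split_ifs <;> simp [hβ0.le]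
    simp only [hadef, hΛ x x.2]
    linarith [hE.2]
  have hN : ∀ x y, 0 ≤ adjMat Λ x y := fun x y => by
    unfold adjMat
    split_ifs <;> norm_num
  have hsymm : ∀ x y, adjMat Λ x y = adjMat Λ y x := fun x y => by
    simp only [adjMat, l1dist_comm (x : Site d)]
  have hrow : ∀ x, ∑ y, adjMat Λ x y ≤ 2 * (d : ℝ) := fun x => sum_adjacent_le Λ x
  have hcoer := coercive_of_dominant hN hsymm hrow ha
  have hdet := (Matrix.isUnit_iff_isUnit_det _).1 (isUnit_of_coercive hδ hcoer)
  have hright := Matrix.mul_nonsing_inv _ hdet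
  have hnorm : ∀ v : Λ → ℝ,
      Real.sqrt (∑ x, ((Matrix.diagonal a - adjMat Λ)⁻¹).mulVec v x ^ 2) ≤
        (1 / δ) * Real.sqrt (∑ x, v x ^ 2) := fun v => by
    have hv := sqrt_le_of_coercive hδ hcoer ((Matrix.diagonal a - adjMat Λ)⁻¹.mulVec v)
    rwa [Matrix.mulVec_mulVec, hright, Matrix.one_mulVec] at hv
  refine ⟨(Matrix.diagonal a - adjMat Λ)⁻¹, hright, Matrix.nonsing_inv_mul _ hdet, hnorm, ?_⟩
  intro x y
  have hsup : ∀ z, |(Matrix.diagonal a - adjMat Λ)⁻¹ z y| ≤ 1 / δ := fun z => by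
    have hy := hnorm (Pi.single y 1)
    simp only [Matrix.mulVec_single_one, Matrix.col_apply, Pi.single_apply, ite_pow, one_pow,
      ne_eq, OfNat.ofNat_ne_zero, not_false_eq_true, zero_pow, Finset.sum_ite_eq',
      Finset.mem_univ, if_true, Real.sqrt_one, mul_one] at hy
    refine (Real.abs_le_sqrt ?_).trans hy
    exact Finset.single_le_sum
      (f := fun w => (Matrix.diagonal a - adjMat Λ)⁻¹ w y ^ 2)
      (fun w _ => sq_nonneg _) (Finset.mem_univ z)
  have hdecay := abs_inv_entry_le hd0.le hδ hN hrow ha hright hsup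
    (ρ := fun z => (l1dist (z : Site d) (y : Site d)).toNat) (by simp [l1dist_self])
    (fun z w hzw => by
      have hadj : l1dist (z : Site d) (w : Site d) = 1 := by
        by_contra hne
        exact hzw (if_neg hne)
      have := l1dist_triangle (z : Site d) w y
      omega) _ x le_rfl
  convert hdecay using 2
  have hcast : (l1dist (x : Site d) (y : Site d) : ℝ) =
      ((l1dist (x : Site d) (y : Site d)).toNat : ℝ) := by
    exact_mod_cast (Int.toNat_of_nonneg (l1dist_nonneg (x : Site d) y)).symm
  have hratio : 2 * (d : ℝ) / (2 * d + δ) = (1 + δ / (2 * d))⁻¹ := by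
    field_simp
  rw [hcast, hratio, neg_mul, mul_comm, Real.exp_neg, Real.exp_nat_mul, gamma0, ← hδdef,
    Real.exp_log (by positivity), inv_pow]

end HierABM
end
end
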